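/- For the n-element linearly ordered meet-semilattice L_n (n ≥ 2), realized as Fin n with its usual linear order and meet given by min, the number of inconsistent equations in at most m variables equals (2^m − 1)·n(n−1)/2, for every m ≥ 1. -/

import Mathlib

/-- An equation of the first kind in at most `m` variables over a meet-semilattice `S`:
`(⊓_{i ∈ T} x_i) ⊓ s₁ = (⊓_{i ∈ U} x_i) ⊓ s₂` with `T, U` nonempty. -/
structure EqFst (S : Type*) (m : ℕ) where
  T : Finset (Fin m)
  hT : T.Nonempty
  s₁ : S
  U : Finset (Fin m)
  hU : U.Nonempty
  s₂ : S

/-- An equation of the second kind: `(⊓_{i ∈ T} x_i) ⊓ s₁ = s₂` with `T` nonempty. -/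
structure EqSnd (S : Type*) (m : ℕ) where
  T : Finset (Fin m)
  hT : T.Nonempty
  s₁ : S
  s₂ : S

def EqFst.HasSolution {S : Type*} [SemilatticeInf S] {m : ℕ} (e : EqFst S m) : Prop :=
  ∃ v : Fin m → S, (e.T.inf' e.hT v) ⊓ e.s₁ = (e.U.inf' e.hU v) ⊓ e.s₂

def EqSnd.HasSolution {S : Type*} [SemilatticeInf S] {m : ℕ} (e : EqSnd S m) : Prop :=
  ∃ v : Fin m → S, (e.T.inf' e.hT v) ⊓ e.s₁ = e.s₂

/-- The number of inconsistent equations (of both kinds) in at most `m` variables over `S`. -/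
noncomputable def numInconsistent (S : Type*) [SemilatticeInf S] (m : ℕ) : ℕ :=
  Nat.card {e : EqFst S m // ¬ e.HasSolution} + Nat.card {e : EqSnd S m // ¬ e.HasSolution}

theorem EqFst.hasSolution {S : Type*} [SemilatticeInf S] {m : ℕ} (e : EqFst S m) :
    e.HasSolution :=
  ⟨fun _ => e.s₁ ⊓ e.s₂, by
    rw [Finset.inf'_const, Finset.inf'_const, inf_right_comm, inf_idem, inf_assoc, inf_idem]⟩

theorem EqSnd.hasSolution_iff {S : Type*} [SemilatticeInf S] {m : ℕ} (e : EqSnd S m) :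
    e.HasSolution ↔ e.s₂ ≤ e.s₁ := by
  constructor
  · rintro ⟨v, hv⟩
    exact hv ▸ inf_le_right
  · intro h
    exact ⟨fun _ => e.s₂, by rw [Finset.inf'_const, inf_eq_left.mpr h]⟩

/-- Over a linear order, an inconsistent equation of the second kind is a nonempty set of
variables together with a strictly increasing pair of constants. -/
def EqSnd.inconsistentEquiv (S : Type*) [LinearOrder S] (m : ℕ) :
    {e : EqSnd S m // ¬ e.HasSolution} ≃
      {T : Finset (Fin m) // T.Nonempty} × {p : S × S // p.1 < p.2} where
  toFun e := (⟨e.1.T, e.1.hT⟩,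
    ⟨(e.1.s₁, e.1.s₂), not_le.mp (mt e.1.hasSolution_iff.mpr e.2)⟩)
  invFun q := ⟨⟨q.1.1, q.1.2, q.2.1.1, q.2.1.2⟩,
    fun h => not_le.mpr q.2.2 ((EqSnd.hasSolution_iff _).mp h)⟩
  left_inv _ := rfl
  right_inv _ := rfl

theorem Nat.card_nonempty_finset (α : Type*) [Fintype α] :
    Nat.card {T : Finset α // T.Nonempty} = 2 ^ Fintype.card α - 1 := by
  classical
  simp only [Finset.nonempty_iff_ne_empty]
  rw [Nat.card_eq_fintype_card, Fintype.card_subtype_compl]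
  simp

theorem Fin.card_pairs_lt (n : ℕ) :
    Nat.card {p : Fin n × Fin n // p.1 < p.2} = n * (n - 1) / 2 := by
  let e : {p : Fin n × Fin n // p.1 < p.2} ≃ Σ j : Fin n, Finset.Iio j :=
    { toFun := fun p => ⟨p.1.2, p.1.1, Finset.mem_Iio.mpr p.2⟩
      invFun := fun q => ⟨(q.2.1, q.1), Finset.mem_Iio.mp q.2.2⟩
      left_inv := fun _ => rfl
      right_inv := fun _ => rfl }
  rw [Nat.card_congr e, Nat.card_eq_fintype_card, Fintype.card_sigma]
  simp only [Fintype.card_coe, Fin.card_Iio]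
  rw [Fin.sum_univ_eq_sum_range (fun i => i), Finset.sum_range_id]

/-- The number of inconsistent equations over the `n`-element linearly ordered
meet-semilattice `L_n = Fin n` (with meet given by `min`) equals
`(2^m − 1) · n(n−1)/2`. -/
theorem stmt_2 (n : ℕ) (hn : 2 ≤ n) (m : ℕ) (hm : 1 ≤ m) :
    numInconsistent (Fin n) m = (2 ^ m - 1) * (n * (n - 1) / 2) := by
  have : IsEmpty {e : EqFst (Fin n) m // ¬ e.HasSolution} :=
    ⟨fun e => e.2 e.1.hasSolution⟩
  rw [numInconsistent, Nat.card_of_isEmpty, zero_add,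
    Nat.card_congr (EqSnd.inconsistentEquiv (Fin n) m), Nat.card_prod,
    Nat.card_nonempty_finset, Fintype.card_fin, Fin.card_pairs_lt]
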